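/- arXiv:1901.09342 — 7 statements merged into one kernel-verified Lean document; each statement's English description precedes it below -/
import Mathlib

section
/- Let G be a subgroup of S_n acting on ℝ^n by permuting coordinates, let f : ℝ^n → ℝ be a continuous G-invariant function, let K ⊂ ℝ^n be a compact set, and let ε > 0. Then there exists a G-invariant polynomial q in n real variables (i.e., a polynomial with q(g·x) = q(x) for all g ∈ G, x ∈ ℝ^n) such that |f(x) − q(x)| ≤ ε for all x ∈ K. -/
/-- The action of a permutation `g ∈ Sₙ` on `ℝⁿ` by permuting coordinates:
`(g · x) i = x (g⁻¹ i)`. -/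
def permAct {n : ℕ} (g : Equiv.Perm (Fin n)) (x : Fin n → ℝ) : Fin n → ℝ :=
  fun i => x (g⁻¹ i)

open MvPolynomial in
/-- Multivariate Weierstrass approximation: a continuous function on `ℝ^σ` is uniformly
approximated on compact sets by polynomials. -/
theorem exists_mvPolynomial_near_of_isCompact {σ : Type*} {f : (σ → ℝ) → ℝ}
    (hf : Continuous f) {K : Set (σ → ℝ)} (hK : IsCompact K) {ε : ℝ} (hε : 0 < ε) :
    ∃ p : MvPolynomial σ ℝ, ∀ x ∈ K, |f x - eval x p| < ε := by
  let φ : MvPolynomial σ ℝ →ₐ[ℝ] C(σ → ℝ, ℝ) := aeval fun i => ⟨fun x => x i, continuous_apply i⟩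
  have hφ (p : MvPolynomial σ ℝ) (x : σ → ℝ) : φ p x = eval x p := by
    induction p using MvPolynomial.induction_on with
    | C a => simp [φ]
    | add p q hp hq => simp [hp, hq]
    | mul_X p i hp => simp [hp, φ]
  have hsep : φ.range.SeparatesPoints := by
    intro x y hxy
    obtain ⟨i, hi⟩ := Function.ne_iff.mp hxy
    exact ⟨_, ⟨φ (X i), ⟨X i, rfl⟩, rfl⟩, by simpa [hφ] using hi⟩
  obtain ⟨_, ⟨p, rfl⟩, hp⟩ :=
    ContinuousMap.exists_mem_subalgebra_near_continuous_of_isCompact_of_separatesPoints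
      hsep ⟨f, hf⟩ hK hε
  refine ⟨p, fun x hx => ?_⟩
  rw [abs_sub_comm]
  simpa [hφ] using hp x hx

theorem continuous_permAct {n : ℕ} (g : Equiv.Perm (Fin n)) : Continuous (permAct g) :=
  continuous_pi fun i => continuous_apply (g⁻¹ i)

open MvPolynomial in
/-- The average of the polynomial `p` over the permutation group `G` (the Reynolds operator). -/
noncomputable def groupAverage {n : ℕ} (G : Subgroup (Equiv.Perm (Fin n)))
    (p : MvPolynomial (Fin n) ℝ) : MvPolynomial (Fin n) ℝ :=
  C (Nat.card G : ℝ)⁻¹ * ∑ᶠ g : G, rename (g⁻¹ : Equiv.Perm (Fin n)) p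

open MvPolynomial in
theorem eval_groupAverage {n : ℕ} (G : Subgroup (Equiv.Perm (Fin n))) [Fintype G]
    (p : MvPolynomial (Fin n) ℝ) (x : Fin n → ℝ) :
    eval x (groupAverage G p) = (Fintype.card G : ℝ)⁻¹ * ∑ g : G, eval (permAct g x) p := by
  simp only [groupAverage, finsum_eq_sum_of_fintype, Nat.card_eq_fintype_card, map_mul, eval_C,
    map_sum, eval_rename]
  rfl

open MvPolynomial in
theorem eval_permAct_groupAverage {n : ℕ} {G : Subgroup (Equiv.Perm (Fin n))}
    (p : MvPolynomial (Fin n) ℝ) {g : Equiv.Perm (Fin n)} (hg : g ∈ G) (x : Fin n → ℝ) :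
    eval (permAct g x) (groupAverage G p) = eval x (groupAverage G p) := by
  have := Fintype.ofFinite G
  rw [eval_groupAverage, eval_groupAverage]
  congr 1
  refine Fintype.sum_equiv (Equiv.mulRight (⟨g, hg⟩ : G)) _ _ fun h => ?_
  rfl

/-- a continuous `G`-invariant function on a compact set `K ⊆ ℝⁿ` can be
`ε`-approximated on `K` by a `G`-invariant polynomial. -/
theorem invariant_polynomial_approximation (n : ℕ) (G : Subgroup (Equiv.Perm (Fin n)))
    (f : (Fin n → ℝ) → ℝ) (hfc : Continuous f)
    (hfi : ∀ g ∈ G, ∀ x : Fin n → ℝ, f (permAct g x) = f x)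
    (K : Set (Fin n → ℝ)) (hK : IsCompact K) (ε : ℝ) (hε : 0 < ε) :
    ∃ q : MvPolynomial (Fin n) ℝ,
      (∀ g ∈ G, ∀ x : Fin n → ℝ,
          MvPolynomial.eval (permAct g x) q = MvPolynomial.eval x q) ∧
      ∀ x ∈ K, |f x - MvPolynomial.eval x q| ≤ ε := by
  have := Fintype.ofFinite G
  obtain ⟨p, hp⟩ := exists_mvPolynomial_near_of_isCompact hfc
    (isCompact_iUnion fun g : G => hK.image (continuous_permAct g)) hε
  refine ⟨groupAverage G p, fun g hg x => eval_permAct_groupAverage p hg x, fun x hx => ?_⟩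
  have hcard : (0 : ℝ) < Fintype.card G := by exact_mod_cast Fintype.card_pos
  have hsplit : f x - MvPolynomial.eval x (groupAverage G p) = (Fintype.card G : ℝ)⁻¹ *
      ∑ g : G, (f (permAct g x) - MvPolynomial.eval (permAct g x) p) := by
    simp only [eval_groupAverage, Finset.sum_sub_distrib, hfi _ (SetLike.coe_mem _), mul_sub,
      Finset.sum_const, Finset.card_univ, nsmul_eq_mul]
    rw [inv_mul_cancel_left₀ hcard.ne']
  rw [hsplit, abs_mul, abs_of_pos (inv_pos.mpr hcard), inv_mul_le_iff₀ hcard]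
  calc |∑ g : G, (f (permAct g x) - MvPolynomial.eval (permAct g x) p)|
      ≤ ∑ g : G, |f (permAct g x) - MvPolynomial.eval (permAct g x) p| :=
        Finset.abs_sum_le_sum_abs _ _
    _ ≤ ∑ _g : G, ε := Finset.sum_le_sum fun g _ =>
        (hp _ (Set.mem_iUnion.mpr ⟨g, Set.mem_image_of_mem _ hx⟩)).le
    _ = Fintype.card G * ε := by simp
end

section
/- Let G ≤ S_n, let k ∈ ℕ, let τ be a k-class, and let ℓ ∈ Fin k. Define the linear map L^τ_ℓ from ℝ^n to tensors of order k by L^τ_ℓ(x)(i) = x_{i(ℓ)} if i ∈ τ and L^τ_ℓ(x)(i) = 0 otherwise, for tuples i : Fin k → Fin n. Then L^τ_ℓ is G-equivariant: for all g ∈ G, x ∈ ℝ^n, and tuples i, one has L^τ_ℓ(g·x)(i) = L^τ_ℓ(x)(g⁻¹ ∘ i); that is, L^τ_ℓ(g·x) = g·L^τ_ℓ(x). -/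
/-- The equivalence relation on index tuples `i : Fin k → Fin n` whose classes are the
`k`-classes: `i ∼ j` iff `j = g ∘ i ∘ σ` for some `g ∈ G` and `σ ∈ S_k`. -/
def tupleSetoid (n k : ℕ) (G : Subgroup (Equiv.Perm (Fin n))) : Setoid (Fin k → Fin n) where
  r i j := ∃ g ∈ G, ∃ σ : Equiv.Perm (Fin k), j = fun ℓ => g (i (σ ℓ))
  iseqv := by
    constructor
    · intro i
      exact ⟨1, G.one_mem, 1, by funext ℓ; simp⟩
    · rintro i j ⟨g, hg, σ, rfl⟩
      exact ⟨g⁻¹, G.inv_mem hg, σ⁻¹, by funext ℓ; simp⟩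
    · rintro i j k ⟨g, hg, σ, rfl⟩ ⟨g', hg', σ', rfl⟩
      exact ⟨g' * g, G.mul_mem hg' hg, σ * σ', by funext ℓ; simp [Equiv.Perm.mul_apply]⟩

open Classical in
/-- The linear map `L^τ_ℓ : ℝⁿ → ℝ^{nᵏ}`, `L^τ_ℓ(x)(i) = x_{i(ℓ)}` if `i ∈ τ`, else `0`. -/
noncomputable def Ltau {n k : ℕ} (τ : Set (Fin k → Fin n)) (ℓ : Fin k)
    (x : Fin n → ℝ) : (Fin k → Fin n) → ℝ :=
  fun i => if i ∈ τ then x (i ℓ) else 0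

/-- A `k`-class is stable under the action of `G` on tuples. -/
theorem comp_inv_mem_iff_of_mem_classes {n k : ℕ} {G : Subgroup (Equiv.Perm (Fin n))}
    {τ : Set (Fin k → Fin n)} (hτ : τ ∈ (tupleSetoid n k G).classes)
    {g : Equiv.Perm (Fin n)} (hg : g ∈ G) (i : Fin k → Fin n) :
    (fun t => g⁻¹ (i t)) ∈ τ ↔ i ∈ τ := by
  obtain ⟨j, rfl⟩ := hτ
  have h : (tupleSetoid n k G) i (fun t => g⁻¹ (i t)) :=
    ⟨g⁻¹, G.inv_mem hg, 1, rfl⟩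
  exact ⟨fun hi => (tupleSetoid n k G).trans h hi,
    fun hi => (tupleSetoid n k G).trans ((tupleSetoid n k G).symm h) hi⟩

/-- for a `k`-class `τ` and `ℓ ∈ Fin k`, the linear map `L^τ_ℓ` is
`G`-equivariant: `L^τ_ℓ(g·x) = g·L^τ_ℓ(x)`, i.e. `L^τ_ℓ(g·x)(i) = L^τ_ℓ(x)(g⁻¹ ∘ i)`. -/
theorem Ltau_equivariant (n k : ℕ) (G : Subgroup (Equiv.Perm (Fin n)))
    (τ : Set (Fin k → Fin n)) (hτ : τ ∈ (tupleSetoid n k G).classes) (ℓ : Fin k) :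
    ∀ g ∈ G, ∀ x : Fin n → ℝ,
      Ltau τ ℓ (fun t => x (g⁻¹ t)) = fun i => Ltau τ ℓ x (fun t => g⁻¹ (i t)) := by
  intro g hg x
  funext i
  classical
  exact if_congr (comp_inv_mem_iff_of_mem_classes hτ hg i).symm rfl rfl
end

section
/- (Noether, permutation-group case) Let G ≤ S_n be a subgroup acting on polynomials in n real variables by permuting the variables. Then there exist finitely many G-invariant polynomials f_1, …, f_m, each of total degree at most |G|, such that every G-invariant polynomial p in n real variables can be expressed as p = h(f_1, …, f_m) for some polynomial h in m variables; equivalently, the G-invariant polynomials form the ℝ-subalgebra generated by f_1, …, f_m. -/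
open MvPolynomial in
/-- The transfer (sum over the group) of a polynomial under a finite permutation group. -/
noncomputable def permTransfer {σ : Type*} (K : Type*) [CommRing K]
    (G : Subgroup (Equiv.Perm σ)) [Fintype G] : MvPolynomial σ K →ₗ[K] MvPolynomial σ K :=
  ∑ g : G, (rename (R := K) ⇑(g : Equiv.Perm σ)).toLinearMap

namespace permTransfer

open MvPolynomial

variable {σ K : Type*} [CommRing K] (G : Subgroup (Equiv.Perm σ)) [Fintype G]

lemma apply_eq_sum (p : MvPolynomial σ K) :
    permTransfer K G p = ∑ g : G, rename ⇑(g : Equiv.Perm σ) p := by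
  simp [permTransfer]

lemma rename_apply {g : Equiv.Perm σ} (hg : g ∈ G) (p : MvPolynomial σ K) :
    rename ⇑g (permTransfer K G p) = permTransfer K G p := by
  simp only [apply_eq_sum, map_sum, rename_rename]
  exact Fintype.sum_equiv (Equiv.mulLeft ⟨g, hg⟩) _ _ fun h => by simp

lemma apply_mul_of_invariant (p : MvPolynomial σ K) {q : MvPolynomial σ K}
    (hq : ∀ g ∈ G, rename ⇑g q = q) :
    permTransfer K G (p * q) = permTransfer K G p * q := by
  simp only [apply_eq_sum, Finset.sum_mul, map_mul]
  exact Finset.sum_congr rfl fun g _ => by rw [hq g g.2]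

lemma apply_of_invariant {p : MvPolynomial σ K} (hp : ∀ g ∈ G, rename ⇑g p = p) :
    permTransfer K G p = (Nat.card G : K) • p := by
  rw [apply_eq_sum, Finset.sum_congr rfl fun (g : G) _ => hp g g.2]
  simp [Nat.cast_smul_eq_nsmul]

lemma totalDegree_apply_le (p : MvPolynomial σ K) :
    (permTransfer K G p).totalDegree ≤ p.totalDegree := by
  rw [apply_eq_sum]
  exact totalDegree_finsetSum_le fun g _ => totalDegree_rename_le _ p

/-- Benson's identity, obtained by expanding `∏ g, (X (v g) - X (h (g (v g)))) = 0` and summing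
over `h`. -/
lemma sum_powerset_eq_zero [DecidableEq G] (v : G → σ) :
    ∑ S : Finset G, (-1) ^ (Sᶜ).card * ((∏ g ∈ S, (X (v g) : MvPolynomial σ K)) *
      permTransfer K G (∏ g ∈ Sᶜ, X ((g : Equiv.Perm σ) (v g)))) = 0 := by
  have key (h : G) : ∏ g : G, ((X (v g) : MvPolynomial σ K) +
      -X ((h : Equiv.Perm σ) ((g : Equiv.Perm σ) (v g)))) = 0 :=
    Finset.prod_eq_zero (Finset.mem_univ h⁻¹) (by simp)
  rw [← Finset.sum_eq_zero fun h (_ : h ∈ Finset.univ) => key h]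
  simp only [Fintype.prod_add, Finset.prod_neg, apply_eq_sum, map_prod, rename_X,
    Finset.mul_sum]
  rw [Finset.sum_comm]
  refine Finset.sum_congr rfl fun h _ => Finset.sum_congr rfl fun S _ => by ring

/-- A subalgebra that contains the transfers of all monomials of degree at most `|G|` contains
the transfers of all monomials, if `|G|` is invertible. -/
lemma multiset_prod_mem (hG : IsUnit (Nat.card G : K)) (A : Subalgebra K (MvPolynomial σ K))
    (hA : ∀ s : Multiset σ, s.card ≤ Nat.card G → permTransfer K G (s.map X).prod ∈ A)
    (s : Multiset σ) : permTransfer K G (s.map X).prod ∈ A := by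
  classical
  induction hs : s.card using Nat.strong_induction_on generalizing s with
  | _ d ih =>
  subst hs
  by_cases hd : s.card ≤ Nat.card G
  · exact hA s hd
  obtain ⟨v, hv⟩ : ∃ v : G → σ, Finset.univ.val.map v ≤ s := by
    obtain ⟨φ⟩ : Nonempty (G ↪ s.ToType) := Function.Embedding.nonempty_of_card_le (by
      rw [← Nat.card_eq_fintype_card, Multiset.card_coe]; exact (not_le.mp hd).le)
    refine ⟨fun g => (φ g : σ), ?_⟩
    have hle := Multiset.map_le_map (f := fun x : s.ToType => (x : σ))
      (Finset.val_le_iff.mpr (Finset.subset_univ (Finset.univ.map φ)))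
    rw [Multiset.map_univ_coe, Finset.map_val, Multiset.map_map] at hle
    exact hle
  obtain ⟨r, rfl⟩ := Multiset.le_iff_exists_add.mp hv
  have hsum := congrArg (fun p => permTransfer K G ((r.map X).prod * p))
    (sum_powerset_eq_zero (K := K) G v)
  simp only [mul_zero, map_zero, Finset.mul_sum, map_sum] at hsum
  have hterm (S : Finset G) : permTransfer K G ((r.map X).prod * ((-1) ^ (Sᶜ).card *
      ((∏ g ∈ S, X (v g)) * permTransfer K G (∏ g ∈ Sᶜ, X ((g : Equiv.Perm σ) (v g)))))) =
      (-1) ^ (Sᶜ).card * (permTransfer K G ((S.val.map v + r).map X).prod *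
        permTransfer K G ((Sᶜ.val.map fun g : G => (g : Equiv.Perm σ) (v g)).map X).prod) := by
    rw [show (-1 : MvPolynomial σ K) ^ (Sᶜ).card = C ((-1) ^ (Sᶜ).card) by simp, mul_left_comm,
      ← smul_eq_C_mul, ← smul_eq_C_mul, map_smul, ← mul_assoc,
      apply_mul_of_invariant G _ fun g hg => rename_apply G hg _]
    simp [Multiset.map_map, mul_comm]
  simp only [hterm] at hsum
  rw [← Finset.add_sum_erase _ _ (Finset.mem_univ Finset.univ)] at hsum
  have hrest : ∑ S ∈ Finset.univ.erase (Finset.univ : Finset G), (-1) ^ (Sᶜ).card *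
      (permTransfer K G ((S.val.map v + r).map X).prod *
        permTransfer K G ((Sᶜ.val.map fun g : G => (g : Equiv.Perm σ) (v g)).map X).prod) ∈ A := by
    refine A.sum_mem fun S hS => A.mul_mem (A.pow_mem (A.neg_mem A.one_mem) _)
      (A.mul_mem (ih _ ?_ _ rfl) (hA _ ?_))
    · simpa using Finset.card_lt_card (Finset.ssubset_univ_iff.mpr (Finset.ne_of_mem_erase hS))
    · simpa [Nat.card_eq_fintype_card] using Finset.card_le_univ Sᶜ
  have hmain : (Nat.card G : K) •
      permTransfer K G (((Finset.univ : Finset G).val.map v + r).map X).prod ∈ A := by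
    have hone : permTransfer K G (1 : MvPolynomial σ K) = C (Nat.card G : K) := by
      rw [apply_of_invariant G fun g _ => map_one _, smul_eq_C_mul, mul_one]
    rw [smul_eq_C_mul, ← hone, mul_comm]
    have := eq_neg_of_add_eq_zero_left hsum
    simp only [Finset.compl_univ, Finset.card_empty, pow_zero, one_mul, Finset.empty_val,
      Multiset.map_zero, Multiset.prod_zero] at this
    rw [this]
    exact A.neg_mem hrest
  exact (Submodule.smul_mem_iff_of_isUnit (Subalgebra.toSubmodule A) hG).mp hmain

/-- If `|G|` is invertible, the invariants are generated by the transfers of monomials of degree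
at most `|G|`. -/
lemma mem_of_invariant (hG : IsUnit (Nat.card G : K)) (A : Subalgebra K (MvPolynomial σ K))
    (hA : ∀ s : Multiset σ, s.card ≤ Nat.card G → permTransfer K G (s.map X).prod ∈ A)
    {p : MvPolynomial σ K} (hp : ∀ g ∈ G, rename ⇑g p = p) : p ∈ A := by
  have hmem : permTransfer K G p ∈ A := by
    clear hp
    induction p using MvPolynomial.induction_on' with
    | monomial u a =>
      have hu : monomial u a = a • (u.toMultiset.map X).prod := by
        rw [Finsupp.toMultiset_map, Finsupp.prod_toMultiset, monomial_eq, smul_eq_C_mul]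
        simp [Finsupp.prod_mapDomain_index, pow_add]
      rw [hu, map_smul]
      exact A.smul_mem (multiset_prod_mem G hG A hA _) a
    | add p q hp hq => rw [map_add]; exact A.add_mem hp hq
  rw [apply_of_invariant G hp] at hmem
  exact (Submodule.smul_mem_iff_of_isUnit (Subalgebra.toSubmodule A) hG).mp hmem

end permTransfer

open MvPolynomial in
/-- Noether, permutation-group case: for `G ≤ Sₙ` acting on polynomials by
permuting variables, there are finitely many `G`-invariant polynomials `f₁, …, f_m` of
total degree at most `|G|` such that the `G`-invariant polynomials are exactly the members
of the `ℝ`-subalgebra generated by `f₁, …, f_m`. -/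
theorem noether_finite_generation (n : ℕ) (G : Subgroup (Equiv.Perm (Fin n))) :
    ∃ (m : ℕ) (f : Fin m → MvPolynomial (Fin n) ℝ),
      (∀ i : Fin m,
        (∀ g ∈ G, MvPolynomial.rename ⇑g (f i) = f i) ∧
          (f i).totalDegree ≤ Nat.card G) ∧
      ∀ p : MvPolynomial (Fin n) ℝ,
        (∀ g ∈ G, MvPolynomial.rename ⇑g p = p) ↔ p ∈ Algebra.adjoin ℝ (Set.range f) := by
  classical
  have := Fintype.ofFinite G
  let e := Fintype.equivFin (Σ k : Fin (Nat.card G + 1), Sym (Fin n) k)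
  let f i := permTransfer ℝ G (((e.symm i).2 : Multiset (Fin n)).map X).prod
  have hinv (i) : ∀ g ∈ G, rename ⇑g (f i) = f i := fun g hg =>
    permTransfer.rename_apply G hg _
  refine ⟨_, f, fun i => ⟨hinv i, ?_⟩, fun p => ⟨fun hp => ?_, fun hp g hg => ?_⟩⟩
  · refine (permTransfer.totalDegree_apply_le G _).trans ((totalDegree_multiset_prod _).trans ?_)
    simp only [Multiset.map_map, Function.comp_def, totalDegree_X, Multiset.map_const',
      Multiset.sum_replicate, Sym.card_coe, smul_eq_mul, mul_one]
    exact Nat.lt_succ_iff.mp (e.symm i).1.2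
  · refine permTransfer.mem_of_invariant G (by simp) _ (fun s hs => ?_) hp
    refine Algebra.subset_adjoin ⟨e ⟨⟨s.card, Nat.lt_succ_of_le hs⟩, ⟨s, rfl⟩⟩, ?_⟩
    simp only [f]
    rw [Equiv.symm_apply_apply]
    rfl
  · have hle : Algebra.adjoin ℝ (Set.range f) ≤ AlgHom.equalizer (rename ⇑g) (AlgHom.id ℝ _) :=
      Algebra.adjoin_le (by rintro _ ⟨i, rfl⟩; exact hinv i g hg)
    exact hle hp
end

section
/- Let n, m ∈ ℕ with m ≤ n − 2, and let i, j : Fin m → Fin n be two (not necessarily injective) index tuples with the same equality pattern, i.e., for all α, β ∈ Fin m, i(α) = i(β) ⟺ j(α) = j(β). Then there exists an even permutation g ∈ A_n such that g ∘ i = j. -/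
/-- Two tuples in a finite type with the same equality pattern are related by a permutation. -/
theorem exists_perm_apply_eq_of_equality_pattern {ι α : Type*} [Finite α] (i j : ι → α)
    (hpat : ∀ a b, i a = i b ↔ j a = j b) : ∃ g : Equiv.Perm α, ∀ l, g (i l) = j l := by
  obtain ⟨g, hg⟩ := Equiv.Perm.exists_extending_pair (Subtype.val : Set.range i → α)
    (fun x => j (Set.rangeSplitting i x)) Subtype.val_injective fun x y hxy =>
      Subtype.ext <| by
        simpa only [Set.apply_rangeSplitting] using (hpat _ _).mpr hxy
  refine ⟨g, fun l => ?_⟩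
  exact (hg ⟨i l, l, rfl⟩).trans
    ((hpat _ _).mp (Set.apply_rangeSplitting i ⟨i l, l, rfl⟩))

/-- A tuple of length at most `n - 2` misses two distinct values of `Fin n`, for `2 ≤ n`. -/
theorem exists_ne_notMem_range_of_add_two_le {n m : ℕ} (h : m + 2 ≤ n) (i : Fin m → Fin n) :
    ∃ a b : Fin n, a ≠ b ∧ (∀ l, i l ≠ a) ∧ ∀ l, i l ≠ b := by
  have hcard : (Finset.univ.image i).card ≤ m := by
    simpa using Finset.card_image_le (s := Finset.univ) (f := i)
  have hcompl : 1 < (Finset.univ.image i)ᶜ.card := by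
    rw [Finset.card_compl, Fintype.card_fin]
    omega
  obtain ⟨a, ha, b, hb, hab⟩ := Finset.one_lt_card.mp hcompl
  exact ⟨a, b, hab, by simpa using ha, by simpa using hb⟩

/-- if `m ≤ n - 2` and two index tuples `i, j : Fin m → Fin n` have the same
equality pattern, then they are related by an *even* permutation of `Fin n`. -/
theorem alternating_orbit_of_equality_pattern (n m : ℕ) (hm : m ≤ n - 2)
    (i j : Fin m → Fin n) (hpat : ∀ α β : Fin m, i α = i β ↔ j α = j β) :
    ∃ g ∈ alternatingGroup (Fin n), (fun ℓ => g (i ℓ)) = j := by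
  rcases Nat.eq_zero_or_pos m with rfl | hpos
  · exact ⟨1, one_mem _, Subsingleton.elim _ _⟩
  obtain ⟨g, hg⟩ := exists_perm_apply_eq_of_equality_pattern i j hpat
  rcases Int.units_eq_one_or (Equiv.Perm.sign g) with hsign | hsign
  · exact ⟨g, Equiv.Perm.mem_alternatingGroup.mpr hsign, funext hg⟩
  · obtain ⟨a, b, hab, ha, hb⟩ := exists_ne_notMem_range_of_add_two_le (by omega) i
    refine ⟨g * Equiv.swap a b, ?_, funext fun l => ?_⟩
    · rw [Equiv.Perm.mem_alternatingGroup, map_mul, hsign, Equiv.Perm.sign_swap hab]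
      rfl
    · rw [Equiv.Perm.mul_apply, Equiv.swap_apply_of_ne_of_ne (ha l) (hb l), hg]
end

section
/- Let n, m ∈ ℕ with m ≤ n − 2, and let T : (Fin m → Fin n) → ℝ be a tensor satisfying the A_n fixed point equation T(g ∘ i) = T(i) for all g ∈ A_n and all tuples i : Fin m → Fin n. Then T satisfies the S_n fixed point equation: T(g ∘ i) = T(i) for all g ∈ S_n and all tuples i. Consequently, the spaces of A_n-equivariant and S_n-equivariant linear layers between tensors of orders k and l with k + l ≤ n − 2 coincide. -/
/-- A permutation can be replaced by an even one without changing its values on a set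
that misses at least two points. -/
theorem exists_mem_alternatingGroup_eqOn {α : Type*} [Fintype α] [DecidableEq α]
    (s : Finset α) (hs : s.card ≤ Fintype.card α - 2) (g : Equiv.Perm α) :
    ∃ h ∈ alternatingGroup α, ∀ x ∈ s, h x = g x := by
  rcases Int.units_eq_one_or (Equiv.Perm.sign g) with hg | hg
  · exact ⟨g, Equiv.Perm.mem_alternatingGroup.2 hg, fun _ _ => rfl⟩
  · have hcard : 1 < Fintype.card α := by
      by_contra hlt
      have : Subsingleton α := Fintype.card_le_one_iff_subsingleton.1 (not_lt.1 hlt)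
      rw [Subsingleton.elim g 1, Equiv.Perm.sign_one] at hg
      exact absurd hg (by decide)
    have hcompl : 1 < sᶜ.card := by
      rw [Finset.card_compl]
      omega
    obtain ⟨a, ha, b, hb, hab⟩ := Finset.one_lt_card.1 hcompl
    rw [Finset.mem_compl] at ha hb
    refine ⟨g * Equiv.swap a b, ?_, fun x hx => ?_⟩
    · rw [Equiv.Perm.mem_alternatingGroup, map_mul, hg, Equiv.Perm.sign_swap hab]
      decide
    · rw [Equiv.Perm.mul_apply, Equiv.swap_apply_of_ne_of_ne]
      · rintro rfl
        exact ha hx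
      · rintro rfl
        exact hb hx

/-- Permuting the indices of a standard basis tensor gives a standard basis tensor. -/
theorem single_comp_perm_inv {ι α : Type*} [DecidableEq (ι → α)]
    (g : Equiv.Perm α) (p : ι → α) (c : ℝ) :
    (fun i : ι → α => (Pi.single p c : (ι → α) → ℝ) fun t => g⁻¹ (i t)) =
      Pi.single (fun t => g (p t)) c := by
  ext i
  have hiff : (fun t => g⁻¹ (i t)) = p ↔ i = fun t => g (p t) := by
    simp only [funext_iff, Equiv.Perm.inv_eq_iff_eq]
  simp only [Pi.single_apply, hiff]

/-- for `m ≤ n - 2`, a tensor `T : ℝ^{nᵐ}` satisfying the `Aₙ` fixed point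
equation also satisfies the `Sₙ` fixed point equation; consequently, for `k + l ≤ n - 2`
the `Aₙ`-equivariant and `Sₙ`-equivariant linear layers between tensors of orders `k` and
`l` coincide. -/
theorem alternating_fixed_point_is_symmetric (n m : ℕ) (hm : m ≤ n - 2)
    (T : (Fin m → Fin n) → ℝ)
    (hT : ∀ g ∈ alternatingGroup (Fin n), ∀ i : Fin m → Fin n,
      T (fun ℓ => g (i ℓ)) = T i) :
    (∀ (g : Equiv.Perm (Fin n)) (i : Fin m → Fin n), T (fun ℓ => g (i ℓ)) = T i) ∧
      ∀ k l : ℕ, k + l ≤ n - 2 →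
        {L : ((Fin k → Fin n) → ℝ) →ₗ[ℝ] ((Fin l → Fin n) → ℝ) |
            ∀ g ∈ alternatingGroup (Fin n), ∀ X : (Fin k → Fin n) → ℝ,
              L (fun i => X fun t => g⁻¹ (i t)) = fun j => L X fun t => g⁻¹ (j t)} =
          {L : ((Fin k → Fin n) → ℝ) →ₗ[ℝ] ((Fin l → Fin n) → ℝ) |
            ∀ (g : Equiv.Perm (Fin n)), ∀ X : (Fin k → Fin n) → ℝ,
              L (fun i => X fun t => g⁻¹ (i t)) = fun j => L X fun t => g⁻¹ (j t)} := by
  constructor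
  · intro g i
    obtain ⟨h, hh, hgi⟩ := exists_mem_alternatingGroup_eqOn (Finset.univ.image i)
      (by simpa using Finset.card_image_le.trans (by simpa using hm)) g
    rw [← hT h hh i]
    congr 1
    ext1 t
    exact (hgi _ (Finset.mem_image_of_mem i (Finset.mem_univ t))).symm
  · intro k l hkl
    ext L
    refine ⟨fun hL g => ?_, fun hL g _ => hL g⟩
    suffices heq : L ∘ₗ LinearMap.funLeft ℝ ℝ (fun (i : Fin k → Fin n) t => g⁻¹ (i t)) =
        LinearMap.funLeft ℝ ℝ (fun (j : Fin l → Fin n) t => g⁻¹ (j t)) ∘ₗ L from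
      fun X => LinearMap.congr_fun heq X
    refine LinearMap.pi_ext fun p c => funext fun j => ?_
    change L (fun i => (Pi.single p c : (Fin k → Fin n) → ℝ) fun t => g⁻¹ (i t)) j =
      L (Pi.single p c) fun t => g⁻¹ (j t)
    have hcard : (Finset.univ.image p ∪ Finset.univ.image fun t => g⁻¹ (j t)).card ≤
        Fintype.card (Fin n) - 2 := by
      refine (Finset.card_union_le _ _).trans
        ((add_le_add Finset.card_image_le Finset.card_image_le).trans ?_)
      simpa using hkl
    obtain ⟨h, hh, hgh⟩ := exists_mem_alternatingGroup_eqOn _ hcard g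
    have hp : (fun t => g (p t)) = fun t => h (p t) := funext fun t =>
      (hgh _ (Finset.mem_union_left _ (Finset.mem_image_of_mem p (Finset.mem_univ t)))).symm
    have hj : (fun t => g⁻¹ (j t)) = fun t => h⁻¹ (j t) := funext fun t => by
      rw [eq_comm, Equiv.Perm.inv_eq_iff_eq, hgh _ (Finset.mem_union_right _
        (Finset.mem_image_of_mem (fun t => g⁻¹ (j t)) (Finset.mem_univ t)))]
      exact (g.apply_symm_apply (j t)).symm
    rw [single_comp_perm_inv, hp, hj, ← single_comp_perm_inv]
    exact congrFun (hL h hh _) j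
end

section
/- Let G < H ≤ S_n be a strict inclusion of subgroups of the symmetric group. Then there exists a continuous function f : ℝ^n → ℝ that is G-invariant (f(g·x) = f(x) for all g ∈ G, x ∈ ℝ^n) but not H-invariant (there exist h ∈ H and x ∈ ℝ^n with f(h·x) ≠ f(x)). -/
/-- for a strict inclusion of subgroups `G < H ≤ Sₙ` there is a continuous
function `f : ℝⁿ → ℝ` that is `G`-invariant but not `H`-invariant. -/
theorem exists_continuous_G_invariant_not_H_invariant (n : ℕ)
    (G H : Subgroup (Equiv.Perm (Fin n))) (hGH : G < H) :
    ∃ f : (Fin n → ℝ) → ℝ, Continuous f ∧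
      (∀ g ∈ G, ∀ x : Fin n → ℝ, f (fun i => x (g⁻¹ i)) = f x) ∧
      ∃ h ∈ H, ∃ x : Fin n → ℝ, f (fun i => x (h⁻¹ i)) ≠ f x := by
  classical
  obtain ⟨h, hH, hG⟩ := SetLike.exists_of_lt hGH
  let v : Fin n → ℝ := fun i => ((i : ℕ) : ℝ)
  -- The product of the distances from `v` to the points of the orbit of `x` under `G`.
  refine ⟨fun x => ∏ g : G, dist (fun i => x ((g : Equiv.Perm (Fin n)) i)) v, by fun_prop,
    fun k hk x => ?_, h, hH, v, ?_⟩
  · exact Fintype.prod_equiv (Equiv.mulLeft (⟨k, hk⟩ : G)⁻¹) _ _ fun g => rfl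
  · have hv : ∏ g : G, dist (fun i => v ((g : Equiv.Perm (Fin n)) i)) v = 0 :=
      Finset.prod_eq_zero (Finset.mem_univ 1) (dist_self v)
    beta_reduce
    rw [hv, Finset.prod_ne_zero_iff]
    intro g _ hg
    have hgh : h⁻¹ * (g : Equiv.Perm (Fin n)) = 1 := by
      ext i
      exact Nat.cast_injective (R := ℝ) (congrFun (dist_eq_zero.mp hg) i)
    exact hG (inv_mul_eq_one.mp hgh ▸ g.2)
end

section
/- Let G ≤ S_n, let k, l ∈ ℕ, let T : (Fin l → Fin n) → (Fin k → Fin n) → ℝ, and let B : (Fin l → Fin n) → ℝ. Define the affine map L from order-k tensors to order-l tensors by L(X)(j) = ∑_{i : Fin k → Fin n} T(j, i) · X(i) + B(j). Then L is G-equivariant, i.e., L(g·X) = g·L(X) for all g ∈ G and all X : (Fin k → Fin n) → ℝ, if and only if T(g ∘ j, g ∘ i) = T(j, i) and B(g ∘ j) = B(j) for all g ∈ G and all tuples i : Fin k → Fin n, j : Fin l → Fin n. -/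
/-- Reindexing a sum over tuples by the permutation `g` acting on their entries. -/
theorem sum_mul_comp_perm_inv {ι α R : Type*} [Fintype ι] [DecidableEq ι] [Fintype α]
    [NonUnitalNonAssocSemiring R] (g : Equiv.Perm α) (c X : (ι → α) → R) :
    (∑ i : ι → α, c i * X fun t => g⁻¹ (i t)) = ∑ i : ι → α, c (fun t => g (i t)) * X i := by
  refine (Fintype.sum_equiv ((Equiv.refl ι).arrowCongr g) _ _ fun i => ?_).symm
  simp [Equiv.arrowCongr, Function.comp_def]

/-- the affine layer `L(X)(j) = ∑_i T(j,i)·X(i) + B(j)` from order-`k`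
tensors to order-`l` tensors is `G`-equivariant (`L(g·X) = g·L(X)`, where
`(g·X)(i) = X(g⁻¹ ∘ i)`) iff `T` and `B` satisfy the fixed point equations
`T(g∘j, g∘i) = T(j,i)` and `B(g∘j) = B(j)` for all `g ∈ G`. -/
theorem affine_layer_equivariant_iff (n k l : ℕ) (G : Subgroup (Equiv.Perm (Fin n)))
    (T : (Fin l → Fin n) → (Fin k → Fin n) → ℝ) (B : (Fin l → Fin n) → ℝ) :
    (∀ g ∈ G, ∀ X : (Fin k → Fin n) → ℝ, ∀ j : Fin l → Fin n,
        (∑ i : Fin k → Fin n, T j i * X fun t => g⁻¹ (i t)) + B j =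
          (∑ i : Fin k → Fin n, T (fun t => g⁻¹ (j t)) i * X i) +
            B fun t => g⁻¹ (j t)) ↔
      ∀ g ∈ G,
        (∀ (j : Fin l → Fin n) (i : Fin k → Fin n),
            T (fun t => g (j t)) (fun t => g (i t)) = T j i) ∧
          ∀ j : Fin l → Fin n, B (fun t => g (j t)) = B j := by
  simp only [sum_mul_comp_perm_inv]
  constructor
  · intro h g hg
    have hB : ∀ j : Fin l → Fin n, B (fun t => g (j t)) = B j := fun j => by
      simpa using h g hg 0 fun t => g (j t)
    refine ⟨fun j i => ?_, hB⟩
    simpa [Pi.single_apply, hB j] using h g hg (Pi.single i 1) fun t => g (j t)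
  · intro h g hg X j
    obtain ⟨hT, hB⟩ := h g hg
    have hT' := hT fun t => g⁻¹ (j t)
    have hB' := hB fun t => g⁻¹ (j t)
    simp only [Equiv.Perm.coe_inv, Equiv.apply_symm_apply] at hT' hB'
    simp only [Equiv.Perm.coe_inv, hT', hB']
end
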